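/- arXiv:2108.00366 — 6 statements merged into one kernel-verified Lean document; each statement's English description precedes it below -/
import Mathlib

section
/- In a finite signalized model, for every global-state trajectory σ0 : Fin (t+1) → S0, summing the joint trajectory probability over all joint-local trajectories σN : Fin (t+1) → SN and joint-action sequences a : Fin t → A yields (∑_{sN} μ (σ0 0) sN) · ∏_{k<t} T0 (σ0 k) (σ0 (k+1)). In particular, the marginal law of the global-state trajectory is the Markov chain with initial distribution s0 ↦ ∑_{sN} μ s0 sN and transition matrix T0, and does not depend on TN or on the policy π. -/
theorem chain_sum_aux {SN : Type} [Fintype SN] (t : ℕ) (f : SN → ℝ)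
    (K : Fin t → SN → SN → ℝ) (c : Fin t → ℝ) (h : ∀ k s, ∑ s', K k s s' = c k) :
    ∑ σ : Fin (t + 1) → SN, f (σ 0) * ∏ k : Fin t, K k (σ k.castSucc) (σ k.succ)
      = (∑ s, f s) * ∏ k, c k := by
  induction t with
  | zero =>
    rw [← (Equiv.funUnique (Fin 1) SN).symm.sum_comp]
    simp
  | succ t ih =>
    rw [← (Fin.snocEquiv (fun _ : Fin (t + 2) => SN)).sum_comp, Fintype.sum_prod_type_right,
      Fin.prod_univ_castSucc, ← mul_assoc,
      ← ih (fun k => K k.castSucc) (fun k => c k.castSucc) (fun k s => h _ s), Finset.sum_mul]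
    refine Finset.sum_congr rfl fun τ _ => ?_
    rw [← h (Fin.last t) (τ (Fin.last t)), Finset.mul_sum]
    refine Finset.sum_congr rfl fun s _ => ?_
    have e0 : (Fin.snoc τ s : Fin (t + 2) → SN) 0 = τ 0 :=
      Fin.snoc_castSucc (α := fun _ => SN) s τ 0
    simp only [Fin.snocEquiv, Equiv.coe_fn_mk, Fin.prod_univ_castSucc, Fin.succ_castSucc,
      Fin.snoc_castSucc, Fin.succ_last, Fin.snoc_last, e0]
    ring

/-- In a finite signalized model, for every global-state trajectory
`σ0 : Fin (t+1) → S0`, summing the joint trajectory probability over all joint-local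
trajectories `σN` and joint-action sequences `a` yields
`(∑ sN, μ (σ0 0) sN) * ∏ k < t, T0 (σ0 k) (σ0 (k+1))`; i.e., the marginal law of the
global-state trajectory is the Markov chain with initial distribution
`s0 ↦ ∑ sN, μ s0 sN` and transition matrix `T0`, independent of `TN` and `π`. -/
theorem signalized_global_marginal
    {S0 SN A : Type} [Fintype S0] [Nonempty S0] [Fintype SN] [Nonempty SN]
    [Fintype A] [Nonempty A]
    (t : ℕ)
    (μ : S0 → SN → ℝ) (hμ_nonneg : ∀ s0 sN, 0 ≤ μ s0 sN)
    (hμ_sum : ∑ s0 : S0, ∑ sN : SN, μ s0 sN = 1)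
    (T0 : S0 → S0 → ℝ) (hT0_nonneg : ∀ s0 s0', 0 ≤ T0 s0 s0')
    (hT0_sum : ∀ s0 : S0, ∑ s0' : S0, T0 s0 s0' = 1)
    (TN : SN → S0 → A → SN → ℝ) (hTN_nonneg : ∀ sN s0 a sN', 0 ≤ TN sN s0 a sN')
    (hTN_sum : ∀ (sN : SN) (s0 : S0) (a : A), ∑ sN' : SN, TN sN s0 a sN' = 1)
    (π : S0 → SN → A → ℝ) (hπ_nonneg : ∀ s0 sN a, 0 ≤ π s0 sN a)
    (hπ_sum : ∀ (s0 : S0) (sN : SN), ∑ a : A, π s0 sN a = 1)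
    (σ0 : Fin (t + 1) → S0) :
    ∑ σN : Fin (t + 1) → SN, ∑ a : Fin t → A,
      (μ (σ0 0) (σN 0) *
        ∏ k : Fin t,
          (π (σ0 k.castSucc) (σN k.castSucc) (a k) *
            T0 (σ0 k.castSucc) (σ0 k.succ) *
            TN (σN k.castSucc) (σ0 k.castSucc) (a k) (σN k.succ)))
      = (∑ sN : SN, μ (σ0 0) sN) * ∏ k : Fin t, T0 (σ0 k.castSucc) (σ0 k.succ) := by
  classical
  rw [← chain_sum_aux t (μ (σ0 0))
    (fun k s s' => ∑ a : A, π (σ0 k.castSucc) s a * T0 (σ0 k.castSucc) (σ0 k.succ) *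
      TN s (σ0 k.castSucc) a s') _ ?_]
  · refine Finset.sum_congr rfl fun σN _ => ?_
    rw [← Finset.mul_sum, Finset.prod_univ_sum, Fintype.piFinset_univ]
  · intro k s
    rw [Finset.sum_comm]
    simp only [← Finset.mul_sum, hTN_sum, mul_one]
    rw [← Finset.sum_mul, hπ_sum, one_mul]
end

section
/- (Proposition 2, posterior form) In a finite TI-AASEP model with n agents and horizon t, fix a global observation sequence ω0 : Fin (t+1) → O0 and assume the normalizer N := ∑ over all σ0, all agents' trajectories σi, actions ai, and observations ωi of P is positive. Then for every global trajectory σ0, the conditional probability of σ0 given ω0 — namely (∑ over all agents' variables of P) / N — equals the HMM posterior [μ0 (σ0 0) · (∏_{k<t} T0 (σ0 k) (σ0 (k+1))) · (∏_{k≤t} Z0 (σ0 k) (ω0 k))] / [∑_{τ0 : Fin (t+1) → S0} μ0 (τ0 0) · (∏_{k<t} T0 (τ0 k) (τ0 (k+1))) · (∏_{k≤t} Z0 (τ0 k) (ω0 k))]; that is, inference of the global state from global observations alone in a TI-AASEP coincides with inference in the hidden Markov model (S0, μ0, T0, O0, Z0). -/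
theorem aux_prod_sum {ι : Type} [Fintype ι] [DecidableEq ι] {κ : ι → Type} [∀ i, Fintype (κ i)]
    (f : ∀ i, κ i → ℝ) : ∑ x : ∀ i, κ i, ∏ i, f i (x i) = ∏ i, ∑ j, f i j := by
  rw [Finset.prod_univ_sum, Fintype.piFinset_univ]

theorem aux_chain {S : Type} [Fintype S] (t : ℕ) : ∀ (m : S → ℝ) (_ : ∑ s, m s = 1)
    (M : Fin t → S → S → ℝ) (_ : ∀ k s, ∑ s', M k s s' = 1),
    ∑ σ : Fin (t + 1) → S, m (σ 0) * ∏ k : Fin t, M k (σ k.castSucc) (σ k.succ) = 1 := by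
  induction t with
  | zero =>
    intro m hm M _
    rw [← hm, ← (Equiv.funUnique (Fin 1) S).sum_comp]
    simp
  | succ t ih =>
    intro m hm M hM
    rw [← (Fin.consEquiv (fun _ : Fin (t + 2) => S)).sum_comp, Fintype.sum_prod_type, ← hm]
    refine Finset.sum_congr rfl fun s _ => ?_
    have h := ih (fun s' => M 0 s s') (hM 0 s) (fun k => M k.succ) (fun k => hM k.succ)
    simp only [Fin.consEquiv_apply, Fin.cons_zero, Fin.prod_univ_succ, Fin.castSucc_zero,
      Fin.cons_succ, Fin.castSucc_succ]
    rw [← Finset.mul_sum, h, mul_one]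

theorem aux_agent {S0 S A O : Type} [Fintype S] [Fintype A] [Fintype O] (t : ℕ)
    (μ : S → ℝ) (hμ : ∑ s, μ s = 1) (π : S0 → S → A → ℝ) (hπ : ∀ s0 s, ∑ a, π s0 s a = 1)
    (T : S → A → S → ℝ) (hT : ∀ s a, ∑ s', T s a s' = 1)
    (Z : S → O → ℝ) (hZ : ∀ s, ∑ o, Z s o = 1) (σ0 : Fin (t + 1) → S0) :
    ∑ σ : Fin (t + 1) → S, ∑ a : Fin t → A, ∑ ω : Fin (t + 1) → O,
      (μ (σ 0) * (∏ k : Fin t, π (σ0 k.castSucc) (σ k.castSucc) (a k) *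
        T (σ k.castSucc) (a k) (σ k.succ)) * ∏ k : Fin (t + 1), Z (σ k) (ω k)) = 1 := by
  have h := aux_chain t μ hμ (fun k s s' => ∑ a, π (σ0 k.castSucc) s a * T s a s') (by
    intro k s
    rw [Finset.sum_comm]
    simp only [← Finset.mul_sum, hT, mul_one, hπ])
  rw [← h]
  refine Finset.sum_congr rfl fun σ _ => ?_
  simp only [← Finset.mul_sum]
  rw [aux_prod_sum (fun k o => Z (σ k) o)]
  simp only [hZ, Finset.prod_const_one, mul_one]
  rw [← Finset.mul_sum,
    aux_prod_sum (fun (k : Fin t) (a : A) => π (σ0 k.castSucc) (σ k.castSucc) a * T (σ k.castSucc) a (σ k.succ))]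

theorem aux_prod_sum3 {ι : Type} [Fintype ι] [DecidableEq ι] {α β γ : ι → Type}
    [∀ i, Fintype (α i)] [∀ i, Fintype (β i)] [∀ i, Fintype (γ i)]
    (f : ∀ i, α i → β i → γ i → ℝ) :
    ∑ x : ∀ i, α i, ∑ y : ∀ i, β i, ∑ z : ∀ i, γ i, ∏ i, f i (x i) (y i) (z i)
      = ∏ i, ∑ x, ∑ y, ∑ z, f i x y z := by
  rw [← aux_prod_sum (fun i x => ∑ y, ∑ z, f i x y z)]
  refine Finset.sum_congr rfl fun x _ => ?_
  rw [← aux_prod_sum (fun i y => ∑ z, f i (x i) y z)]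
  refine Finset.sum_congr rfl fun y _ => ?_
  rw [← aux_prod_sum (fun i z => f i (x i) (y i) z)]


/-- Proposition 2, posterior form: with the global observation sequence
`ω0` fixed and a positive normalizer, the posterior of the global trajectory `σ0` given
`ω0` in the TI-AASEP equals the posterior in the HMM `(S0, μ0, T0, O0, Z0)`. -/
theorem tiaasep_posterior_is_hmm_posterior
    (n t : ℕ)
    {S0 O0 : Type} [Fintype S0] [Nonempty S0] [Fintype O0] [Nonempty O0]
    (S A O : Fin n → Type)
    [∀ i, Fintype (S i)] [∀ i, Nonempty (S i)]
    [∀ i, Fintype (A i)] [∀ i, Nonempty (A i)]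
    [∀ i, Fintype (O i)] [∀ i, Nonempty (O i)]
    (μ0 : S0 → ℝ) (hμ0_nonneg : ∀ s, 0 ≤ μ0 s) (hμ0_sum : ∑ s : S0, μ0 s = 1)
    (T0 : S0 → S0 → ℝ) (hT0_nonneg : ∀ s s', 0 ≤ T0 s s')
    (hT0_sum : ∀ s : S0, ∑ s' : S0, T0 s s' = 1)
    (Z0 : S0 → O0 → ℝ) (hZ0_nonneg : ∀ s o, 0 ≤ Z0 s o)
    (hZ0_sum : ∀ s : S0, ∑ o : O0, Z0 s o = 1)
    (μ : ∀ i, S i → ℝ) (hμ_nonneg : ∀ i s, 0 ≤ μ i s)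
    (hμ_sum : ∀ i, ∑ s : S i, μ i s = 1)
    (π : ∀ i, S0 → S i → A i → ℝ) (hπ_nonneg : ∀ i s0 s a, 0 ≤ π i s0 s a)
    (hπ_sum : ∀ i (s0 : S0) (s : S i), ∑ a : A i, π i s0 s a = 1)
    (T : ∀ i, S i → A i → S i → ℝ) (hT_nonneg : ∀ i s a s', 0 ≤ T i s a s')
    (hT_sum : ∀ i (s : S i) (a : A i), ∑ s' : S i, T i s a s' = 1)
    (Z : ∀ i, S i → O i → ℝ) (hZ_nonneg : ∀ i s o, 0 ≤ Z i s o)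
    (hZ_sum : ∀ i (s : S i), ∑ o : O i, Z i s o = 1)
    (ω0 : Fin (t + 1) → O0)
    (hN : 0 <
      ∑ σ0 : Fin (t + 1) → S0, ∑ σ : ∀ i, Fin (t + 1) → S i, ∑ a : ∀ i, Fin t → A i,
        ∑ ω : ∀ i, Fin (t + 1) → O i,
        (μ0 (σ0 0) * (∏ k : Fin t, T0 (σ0 k.castSucc) (σ0 k.succ)) *
        (∏ k : Fin (t + 1), Z0 (σ0 k) (ω0 k)) *
        ∏ i : Fin n,
          (μ i (σ i 0) *
            (∏ k : Fin t,
              π i (σ0 k.castSucc) (σ i k.castSucc) (a i k) *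
                T i (σ i k.castSucc) (a i k) (σ i k.succ)) *
            ∏ k : Fin (t + 1), Z i (σ i k) (ω i k)))) :
    ∀ σ0 : Fin (t + 1) → S0,
      (∑ σ : ∀ i, Fin (t + 1) → S i, ∑ a : ∀ i, Fin t → A i,
        ∑ ω : ∀ i, Fin (t + 1) → O i,
        (μ0 (σ0 0) * (∏ k : Fin t, T0 (σ0 k.castSucc) (σ0 k.succ)) *
        (∏ k : Fin (t + 1), Z0 (σ0 k) (ω0 k)) *
        ∏ i : Fin n,
          (μ i (σ i 0) *
            (∏ k : Fin t,
              π i (σ0 k.castSucc) (σ i k.castSucc) (a i k) *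
                T i (σ i k.castSucc) (a i k) (σ i k.succ)) *
            ∏ k : Fin (t + 1), Z i (σ i k) (ω i k)))) /
        (∑ σ0 : Fin (t + 1) → S0, ∑ σ : ∀ i, Fin (t + 1) → S i, ∑ a : ∀ i, Fin t → A i,
        ∑ ω : ∀ i, Fin (t + 1) → O i,
        (μ0 (σ0 0) * (∏ k : Fin t, T0 (σ0 k.castSucc) (σ0 k.succ)) *
        (∏ k : Fin (t + 1), Z0 (σ0 k) (ω0 k)) *
        ∏ i : Fin n,
          (μ i (σ i 0) *
            (∏ k : Fin t,
              π i (σ0 k.castSucc) (σ i k.castSucc) (a i k) *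
                T i (σ i k.castSucc) (a i k) (σ i k.succ)) *
            ∏ k : Fin (t + 1), Z i (σ i k) (ω i k))))
      = (μ0 (σ0 0) * (∏ k : Fin t, T0 (σ0 k.castSucc) (σ0 k.succ)) *
          (∏ k : Fin (t + 1), Z0 (σ0 k) (ω0 k))) /
        ∑ τ0 : Fin (t + 1) → S0,
          (μ0 (τ0 0) * (∏ k : Fin t, T0 (τ0 k.castSucc) (τ0 k.succ)) *
          (∏ k : Fin (t + 1), Z0 (τ0 k) (ω0 k))) := by
  have key : ∀ σ0 : Fin (t + 1) → S0,
      ∑ σ : ∀ i, Fin (t + 1) → S i, ∑ a : ∀ i, Fin t → A i,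
        ∑ ω : ∀ i, Fin (t + 1) → O i,
        (∏ i : Fin n,
          (μ i (σ i 0) *
            (∏ k : Fin t,
              π i (σ0 k.castSucc) (σ i k.castSucc) (a i k) *
                T i (σ i k.castSucc) (a i k) (σ i k.succ)) *
            ∏ k : Fin (t + 1), Z i (σ i k) (ω i k))) = 1 := by
    intro σ0
    rw [aux_prod_sum3 (fun i (s : Fin (t + 1) → S i) (a : Fin t → A i) (ω : Fin (t + 1) → O i) =>
      μ i (s 0) * (∏ k : Fin t, π i (σ0 k.castSucc) (s k.castSucc) (a k) *
        T i (s k.castSucc) (a k) (s k.succ)) * ∏ k : Fin (t + 1), Z i (s k) (ω k))]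
    exact Finset.prod_eq_one fun i _ => aux_agent t (μ i) (hμ_sum i) (π i) (hπ_sum i) (T i)
      (hT_sum i) (Z i) (hZ_sum i) σ0
  intro σ0
  simp only [← Finset.mul_sum, key, mul_one]
end

section
/- (Per-agent forward recursion) In a finite TI-AASEP model with n agents and horizon t, fix an agent i < n, a global trajectory σ0 : Fin (t+1) → S0, and an observation sequence ωi : Fin (t+1) → Oi. Define γ : Fin (t+1) → Si → ℝ recursively by γ 0 s := μi s · Zi s (ωi 0) and γ (k+1) s' := (∑_{s ∈ Si} ∑_{a ∈ Ai} γ k s · πi (σ0 k) s a · Ti s a s') · Zi s' (ωi (k+1)). Then ∑_{s ∈ Si} γ t s = L_i(σ0, ωi); i.e., the per-agent evidence contribution is computed exactly by a forward recursion whose per-step cost is independent of the horizon and of the other agents. -/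
theorem sum_snoc_aux {X : Type} [Fintype X] (m : ℕ) (F : (Fin (m + 1) → X) → ℝ) :
    ∑ σ, F σ = ∑ σ : Fin m → X, ∑ x : X, F (Fin.snoc (α := fun _ => X) σ x) := by
  rw [← Equiv.sum_comp (Fin.snocEquiv (fun _ : Fin (m + 1) => X)) F, Fintype.sum_prod_type,
    Finset.sum_comm]
  rfl

theorem fwd_aux {S A : Type} [Fintype S] [Fintype A] (μ : S → ℝ) (T : S → A → S → ℝ) (t : ℕ) :
    ∀ (P : Fin t → S → A → ℝ) (W : Fin (t + 1) → S → ℝ) (γ : Fin (t + 1) → S → ℝ)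
      (_ : ∀ s, γ 0 s = μ s * W 0 s)
      (_ : ∀ (k : Fin t) (s' : S), γ k.succ s' =
        (∑ s : S, ∑ a : A, γ k.castSucc s * P k s a * T s a s') * W k.succ s')
      (f : S → ℝ),
    ∑ s : S, γ (Fin.last t) s * f s
      = ∑ σ : Fin (t + 1) → S, ∑ a : Fin t → A,
          (μ (σ 0) * (∏ k : Fin t, P k (σ k.castSucc) (a k) *
            T (σ k.castSucc) (a k) (σ k.succ)) * ∏ k : Fin (t + 1), W k (σ k)) *
            f (σ (Fin.last t)) := by
  induction t with
  | zero =>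
    intro P W γ h0 _ f
    rw [← (Equiv.funUnique (Fin 1) S).symm.sum_comp]
    simp [h0]
  | succ t ih =>
    intro P W γ h0 hs f
    have key := ih (fun k => P k.castSucc) (fun k => W k.castSucc) (fun k => γ k.castSucc)
      (by intro s; simpa using h0 s) (by intro k s'; simpa using hs k.castSucc s')
      (fun s => ∑ s', ∑ a, P (Fin.last t) s a * T s a s' * W (Fin.last (t + 1)) s' * f s')
    have hl : ∑ s : S, γ (Fin.last (t + 1)) s * f s =
        ∑ s : S, γ (Fin.last t).castSucc s *
          ∑ s', ∑ a, P (Fin.last t) s a * T s a s' * W (Fin.last (t + 1)) s' * f s' := by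
      simp_rw [← Fin.succ_last, hs, Finset.mul_sum, Finset.sum_mul]
      rw [Finset.sum_comm]
      refine Finset.sum_congr rfl fun s _ => Finset.sum_congr rfl fun s' _ =>
        Finset.sum_congr rfl fun a _ => ?_
      ring
    rw [hl, key, sum_snoc_aux (t + 1)]
    refine Finset.sum_congr rfl fun σ _ => ?_
    simp_rw [Finset.mul_sum]
    rw [Finset.sum_comm]
    refine Finset.sum_congr rfl fun s' _ => ?_
    rw [sum_snoc_aux t]
    refine Finset.sum_congr rfl fun b _ => Finset.sum_congr rfl fun a _ => ?_
    have e0 : (Fin.snoc (α := fun _ => S) σ s' : Fin (t + 2) → S) 0 = σ 0 := by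
      rw [← Fin.castSucc_zero, Fin.snoc_castSucc (α := fun _ => S)]
    simp only [e0, Fin.prod_univ_castSucc, Fin.snoc_castSucc (α := fun _ => S), Fin.snoc_castSucc (α := fun _ => A),
      Fin.snoc_last (α := fun _ => S), Fin.snoc_last (α := fun _ => A), Fin.succ_castSucc,
      Fin.succ_last]
    ring

/-- per-agent forward recursion: for a fixed agent `i`, global trajectory
`σ0` and observation sequence `ωi`, the forward recursion `γ` computes the per-agent
evidence contribution: `∑ s, γ t s = L_i(σ0, ωi)`. -/
theorem tiaasep_per_agent_forward_recursion
    (n t : ℕ)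
    {S0 O0 : Type} [Fintype S0] [Nonempty S0] [Fintype O0] [Nonempty O0]
    (S A O : Fin n → Type)
    [∀ i, Fintype (S i)] [∀ i, Nonempty (S i)]
    [∀ i, Fintype (A i)] [∀ i, Nonempty (A i)]
    [∀ i, Fintype (O i)] [∀ i, Nonempty (O i)]
    (μ0 : S0 → ℝ) (hμ0_nonneg : ∀ s, 0 ≤ μ0 s) (hμ0_sum : ∑ s : S0, μ0 s = 1)
    (T0 : S0 → S0 → ℝ) (hT0_nonneg : ∀ s s', 0 ≤ T0 s s')
    (hT0_sum : ∀ s : S0, ∑ s' : S0, T0 s s' = 1)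
    (Z0 : S0 → O0 → ℝ) (hZ0_nonneg : ∀ s o, 0 ≤ Z0 s o)
    (hZ0_sum : ∀ s : S0, ∑ o : O0, Z0 s o = 1)
    (μ : ∀ i, S i → ℝ) (hμ_nonneg : ∀ i s, 0 ≤ μ i s)
    (hμ_sum : ∀ i, ∑ s : S i, μ i s = 1)
    (π : ∀ i, S0 → S i → A i → ℝ) (hπ_nonneg : ∀ i s0 s a, 0 ≤ π i s0 s a)
    (hπ_sum : ∀ i (s0 : S0) (s : S i), ∑ a : A i, π i s0 s a = 1)
    (T : ∀ i, S i → A i → S i → ℝ) (hT_nonneg : ∀ i s a s', 0 ≤ T i s a s')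
    (hT_sum : ∀ i (s : S i) (a : A i), ∑ s' : S i, T i s a s' = 1)
    (Z : ∀ i, S i → O i → ℝ) (hZ_nonneg : ∀ i s o, 0 ≤ Z i s o)
    (hZ_sum : ∀ i (s : S i), ∑ o : O i, Z i s o = 1)
    (i : Fin n)
    (σ0 : Fin (t + 1) → S0) (ωi : Fin (t + 1) → O i)
    (γ : Fin (t + 1) → S i → ℝ)
    (hγ0 : ∀ s : S i, γ 0 s = μ i s * Z i s (ωi 0))
    (hγsucc : ∀ (k : Fin t) (s' : S i),
      γ k.succ s' =
        (∑ s : S i, ∑ a : A i,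
          γ k.castSucc s * π i (σ0 k.castSucc) s a * T i s a s') * Z i s' (ωi k.succ)) :
    ∑ s : S i, γ (Fin.last t) s
      = ∑ σi : Fin (t + 1) → S i, ∑ ai : Fin t → A i,
          μ i (σi 0) *
            (∏ k : Fin t,
              π i (σ0 k.castSucc) (σi k.castSucc) (ai k) *
                T i (σi k.castSucc) (ai k) (σi k.succ)) *
            ∏ k : Fin (t + 1), Z i (σi k) (ωi k) := by
  have h := fwd_aux (μ i) (T i) t (fun k => π i (σ0 k.castSucc)) (fun k s => Z i s (ωi k)) γ
    hγ0 hγsucc (fun _ => 1)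
  simpa only [mul_one] using h
end

section
/- (Forward algorithm correctness) In a finite time-inhomogeneous hidden Markov model with horizon t and fixed observation sequence ω : Fin (t+1) → O, define α : Fin (t+1) → S → ℝ recursively by α 0 s := μ s · Z 0 s (ω 0) and α (k+1) s' := (∑_{s ∈ S} α k s · T k s s') · Z (k+1) s' (ω (k+1)). Then for every k ≤ t and every s ∈ S, α k s = ∑ over trajectories σ : Fin (k+1) → S with σ k = s of μ (σ 0) · (∏_{j<k} T j (σ j) (σ (j+1))) · (∏_{j≤k} Z j (σ j) (ω j)); i.e., α k s equals the joint probability of the first k+1 observations together with the event that the hidden state at time k is s. -/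
/-- forward algorithm correctness: in a finite time-inhomogeneous HMM with
horizon `t` and fixed observations `ω`, the forward variables `α` satisfy, for every
`k ≤ t` and state `s`, `α k s = ∑` over partial hidden trajectories `σ : Fin (k+1) → S`
with `σ k = s` of `μ (σ 0) * (∏ j < k, T j (σ j) (σ (j+1))) * (∏ j ≤ k, Z j (σ j) (ω j))`;
i.e., `α k s` is the joint weight of the first `k+1` observations together with the event
that the hidden state at time `k` is `s`. -/
theorem hmm_forward_algorithm_correct
    {S O : Type} [Fintype S] [DecidableEq S] [Nonempty S] [Fintype O] [Nonempty O]
    (t : ℕ)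
    (μ : S → ℝ) (hμ_nonneg : ∀ s, 0 ≤ μ s)
    (T : Fin t → S → S → ℝ) (hT_nonneg : ∀ k s s', 0 ≤ T k s s')
    (Z : Fin (t + 1) → S → O → ℝ) (hZ_nonneg : ∀ k s o, 0 ≤ Z k s o)
    (ω : Fin (t + 1) → O)
    (α : Fin (t + 1) → S → ℝ)
    (hα0 : ∀ s : S, α 0 s = μ s * Z 0 s (ω 0))
    (hαsucc : ∀ (k : Fin t) (s' : S),
      α k.succ s' = (∑ s : S, α k.castSucc s * T k s s') * Z k.succ s' (ω k.succ)) :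
    ∀ (k : Fin (t + 1)) (s : S),
      α k s =
        ∑ σ ∈ Finset.univ.filter (fun σ : Fin (k.val + 1) → S => σ (Fin.last k.val) = s),
          μ (σ 0) *
            (∏ j : Fin k.val,
              T (j.castLE k.is_le) (σ j.castSucc) (σ j.succ)) *
            ∏ j : Fin (k.val + 1),
              Z (j.castLE (Nat.succ_le_succ k.is_le)) (σ j)
                (ω (j.castLE (Nat.succ_le_succ k.is_le))) := by
  rintro ⟨n, hn⟩
  induction n with
  | zero =>
    intro s
    have h : (Finset.univ.filter (fun σ : Fin (0 + 1) → S => σ (Fin.last 0) = s))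
        = {fun _ => s} := by
      ext σ
      simp only [Finset.mem_filter, Finset.mem_univ, true_and, Finset.mem_singleton]
      constructor
      · intro h
        funext j
        rw [← h]
        congr 1
        exact Subsingleton.elim (α := Fin 1) _ _
      · rintro rfl
        rfl
    refine (hα0 s).trans ?_
    refine Eq.trans ?_ (congrArg (fun A => Finset.sum A _) h.symm)
    rw [Finset.sum_singleton]
    simp
  | succ n ih =>
    intro s
    have hn' : n < t := Nat.lt_of_succ_lt_succ hn
    refine (hαsucc ⟨n, hn'⟩ s).trans ?_
    have ih' := ih (Nat.lt_succ_of_lt hn')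
    have e : (Fin.castSucc ⟨n, hn'⟩ : Fin (t+1)) = ⟨n, Nat.lt_succ_of_lt hn'⟩ := rfl
    rw [e]
    simp only [ih', Finset.sum_filter]
    rw [← (Fin.snocEquiv (fun _ : Fin (n + 1 + 1) => S)).sum_comp, Fintype.sum_prod_type]
    simp only [Fin.snocEquiv, Equiv.coe_fn_mk, Fin.snoc_last]
    conv_rhs => rw [Finset.sum_eq_single s (by
      intro b _ hb
      simp [hb]) (by simp)]
    simp only [if_true, Finset.sum_mul]
    rw [Finset.sum_comm]
    refine Finset.sum_congr rfl fun σ _ => ?_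
    rw [Finset.sum_eq_single (σ (Fin.last n)) (by
      intro b _ hb
      simp [hb.symm]) (by simp)]
    rw [if_pos rfl]
    conv_rhs => rw [Fin.prod_univ_castSucc (n := n), Fin.prod_univ_castSucc (n := n + 1)]
    have h0 : (Fin.snoc σ s : Fin (n + 1 + 1) → S) 0 = σ 0 :=
      Fin.snoc_castSucc (α := fun _ => S) s σ 0
    have hs : ∀ j : Fin n, (Fin.snoc σ s : Fin (n + 1 + 1) → S) j.castSucc.succ = σ j.succ :=
      fun j => Fin.snoc_castSucc (α := fun _ => S) s σ j.succ
    have hl : (Fin.snoc σ s : Fin (n + 1 + 1) → S) (Fin.last n).succ = s :=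
      Fin.snoc_last (α := fun _ => S) s σ
    simp only [h0, hs, hl, Fin.snoc_castSucc, Fin.snoc_last]
    have e1 : ∀ h, Fin.castLE h (Fin.last n) = (⟨n, hn'⟩ : Fin t) := fun _ => rfl
    have e2 : ∀ h, Fin.castLE h (Fin.last (n+1)) = (Fin.succ ⟨n, hn'⟩ : Fin (t+1)) :=
      fun _ => rfl
    have e3 : ∀ (j : Fin n) h h', Fin.castLE h j.castSucc = (Fin.castLE h' j : Fin t) :=
      fun _ _ _ => rfl
    have e4 : ∀ (j : Fin (n+1)) h h', Fin.castLE h j.castSucc = (Fin.castLE h' j : Fin (t+1)) :=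
      fun _ _ _ => rfl
    rw [e1, e2]
    simp only [Fin.castLE_castSucc]
    ring
end

section
/- (Forward-backward smoothing correctness) In a finite time-inhomogeneous hidden Markov model with horizon t and fixed observation sequence ω : Fin (t+1) → O, define α : Fin (t+1) → S → ℝ by α 0 s := μ s · Z 0 s (ω 0) and α (k+1) s' := (∑_{s ∈ S} α k s · T k s s') · Z (k+1) s' (ω (k+1)), and define β : Fin (t+1) → S → ℝ by β t s := 1 and β k s := ∑_{s' ∈ S} T k s s' · Z (k+1) s' (ω (k+1)) · β (k+1) s'. Then for every k ≤ t and every s ∈ S, α k s · β k s = ∑ over full hidden trajectories σ : Fin (t+1) → S with σ k = s of μ (σ 0) · (∏_{j<t} T j (σ j) (σ (j+1))) · (∏_{j≤t} Z j (σ j) (ω j)); i.e., the forward-backward products compute the exact smoothing weights of the hidden state at every time step. -/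
theorem hmm_aux_zero {S : Type} [Fintype S] [DecidableEq S] (t : ℕ) :
    ∀ (μ : S → ℝ) (T : Fin t → S → S → ℝ) (e : Fin (t + 1) → S → ℝ)
    (β : Fin (t + 1) → S → ℝ)
    (_ : ∀ s : S, β (Fin.last t) s = 1)
    (_ : ∀ (k : Fin t) (s : S),
      β k.castSucc s = ∑ s' : S, T k s s' * e k.succ s' * β k.succ s') (s : S),
      μ s * e 0 s * β 0 s =
        ∑ σ : Fin (t + 1) → S, if σ 0 = s then
          μ (σ 0) * (∏ j : Fin t, T j (σ j.castSucc) (σ j.succ)) *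
            ∏ j : Fin (t + 1), e j (σ j) else 0 := by
  induction t with
  | zero =>
    intro μ T e β h1 h2 s
    have h := h1 s
    rw [show Fin.last 0 = 0 from rfl] at h
    rw [← (Equiv.funUnique (Fin 1) S).symm.sum_comp]
    simp [h]
  | succ t ih =>
    intro μ T e β h1 h2 s
    have key : β 0 s = ∑ σ : Fin (t + 1) → S, T 0 s (σ 0) *
        (∏ j : Fin t, T j.succ (σ j.castSucc) (σ j.succ)) *
            ∏ j : Fin (t + 1), e j.succ (σ j) := by
      have := h2 0 s
      rw [Fin.castSucc_zero] at this
      rw [this]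
      have ih' := fun s' => ih (fun s' => T 0 s s') (fun j => T j.succ) (fun j => e j.succ)
        (fun j => β j.succ) (fun s => h1 s) (fun k s => h2 k.succ s) s'
      have e1 : ∀ s', T 0 s s' * e (Fin.succ 0) s' * β (Fin.succ 0) s' = _ := ih'
      rw [Finset.sum_congr rfl (fun s' _ => e1 s'), Finset.sum_comm]
      simp
    rw [← (Fin.consEquiv (fun _ : Fin (t + 2) => S)).sum_comp, Fintype.sum_prod_type]
    simp only [Fin.consEquiv_apply, Fin.cons_zero]
    rw [Finset.sum_eq_single s (by intro b _ hb; simp [hb]) (by simp), key, Finset.mul_sum]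
    refine Finset.sum_congr rfl fun σ _ => ?_
    rw [Fin.prod_univ_succ (fun j : Fin (t + 1) => T j (Fin.cons (α := fun _ => S) s σ j.castSucc) (Fin.cons (α := fun _ => S) s σ j.succ)), Fin.prod_univ_succ (fun j : Fin (t + 2) => e j (Fin.cons (α := fun _ => S) s σ j))]
    simp only [if_true, Fin.castSucc_zero, Fin.cons_zero, Fin.cons_succ, ← Fin.succ_castSucc]
    ring

theorem hmm_aux {S : Type} [Fintype S] [DecidableEq S] (t : ℕ) :
    ∀ (μ : S → ℝ) (T : Fin t → S → S → ℝ) (e : Fin (t + 1) → S → ℝ)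
    (α : Fin (t + 1) → S → ℝ)
    (_ : ∀ s : S, α 0 s = μ s * e 0 s)
    (_ : ∀ (k : Fin t) (s' : S),
      α k.succ s' = (∑ s : S, α k.castSucc s * T k s s') * e k.succ s')
    (β : Fin (t + 1) → S → ℝ)
    (_ : ∀ s : S, β (Fin.last t) s = 1)
    (_ : ∀ (k : Fin t) (s : S),
      β k.castSucc s = ∑ s' : S, T k s s' * e k.succ s' * β k.succ s')
    (k : Fin (t + 1)) (s : S),
      α k s * β k s =
        ∑ σ : Fin (t + 1) → S, if σ k = s then
          μ (σ 0) * (∏ j : Fin t, T j (σ j.castSucc) (σ j.succ)) *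
            ∏ j : Fin (t + 1), e j (σ j) else 0 := by
  induction t with
  | zero =>
    intro μ T e α a1 a2 β h1 h2 k s
    obtain rfl : k = 0 := Fin.ext (by have := k.isLt; simp)
    rw [a1]
    exact hmm_aux_zero 0 μ T e β h1 h2 s
  | succ t ih =>
    intro μ T e α a1 a2 β h1 h2 k s
    refine Fin.cases ?_ (fun k => ?_) k
    · rw [a1]
      exact hmm_aux_zero (t + 1) μ T e β h1 h2 s
    have ih' := ih (fun s' => ∑ s, α 0 s * T 0 s s') (fun j => T j.succ) (fun j => e j.succ)
        (fun j => α j.succ) (fun s => a2 0 s) (fun k s => a2 k.succ s)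
        (fun j => β j.succ) (fun s => h1 s) (fun k s => h2 k.succ s) k s
    refine ih'.trans ?_
    rw [← (Fin.consEquiv (fun _ : Fin (t + 2) => S)).sum_comp, Fintype.sum_prod_type,
      Finset.sum_comm]
    refine Finset.sum_congr rfl fun σ _ => ?_
    simp only [Fin.consEquiv_apply, Fin.cons_zero, Fin.cons_succ]
    split_ifs
    · rw [Finset.sum_mul, Finset.sum_mul]
      refine Finset.sum_congr rfl fun s0 _ => ?_
      rw [Fin.prod_univ_succ (fun j : Fin (t + 1) => T j (Fin.cons (α := fun _ => S) s0 σ j.castSucc) (σ j)), Fin.prod_univ_succ (fun j : Fin (t + 2) => e j (Fin.cons (α := fun _ => S) s0 σ j)), a1]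
      simp only [Fin.castSucc_zero, Fin.cons_zero, Fin.cons_succ, ← Fin.succ_castSucc]
      ring
    · simp

/-- forward-backward smoothing correctness: in a finite time-inhomogeneous
HMM with horizon `t` and fixed observations `ω`, the forward variables `α` and backward
variables `β` satisfy, for every `k ≤ t` and state `s`,
`α k s * β k s = ∑` over full hidden trajectories `σ : Fin (t+1) → S` with `σ k = s` of
`μ (σ 0) * (∏ j < t, T j (σ j) (σ (j+1))) * (∏ j ≤ t, Z j (σ j) (ω j))`;
i.e., the forward-backward products compute the exact smoothing weights. -/
theorem hmm_forward_backward_correct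
    {S O : Type} [Fintype S] [DecidableEq S] [Nonempty S] [Fintype O] [Nonempty O]
    (t : ℕ)
    (μ : S → ℝ) (hμ_nonneg : ∀ s, 0 ≤ μ s)
    (T : Fin t → S → S → ℝ) (hT_nonneg : ∀ k s s', 0 ≤ T k s s')
    (Z : Fin (t + 1) → S → O → ℝ) (hZ_nonneg : ∀ k s o, 0 ≤ Z k s o)
    (ω : Fin (t + 1) → O)
    (α : Fin (t + 1) → S → ℝ)
    (hα0 : ∀ s : S, α 0 s = μ s * Z 0 s (ω 0))
    (hαsucc : ∀ (k : Fin t) (s' : S),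
      α k.succ s' = (∑ s : S, α k.castSucc s * T k s s') * Z k.succ s' (ω k.succ))
    (β : Fin (t + 1) → S → ℝ)
    (hβlast : ∀ s : S, β (Fin.last t) s = 1)
    (hβcast : ∀ (k : Fin t) (s : S),
      β k.castSucc s = ∑ s' : S, T k s s' * Z k.succ s' (ω k.succ) * β k.succ s') :
    ∀ (k : Fin (t + 1)) (s : S),
      α k s * β k s =
        ∑ σ ∈ Finset.univ.filter (fun σ : Fin (t + 1) → S => σ k = s),
          μ (σ 0) *
            (∏ j : Fin t, T j (σ j.castSucc) (σ j.succ)) *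
            ∏ j : Fin (t + 1), Z j (σ j) (ω j) := by


  intro k s
  rw [Finset.sum_filter]
  exact hmm_aux t μ T (fun j s => Z j s (ω j)) α hα0 hαsucc β hβlast hβcast k s
end

section
/- (Action marginalization collapses a TI-AASEP to an HMM with extra emissions) In a finite TI-AASEP model with n agents and horizon t, fix a global trajectory σ0, local trajectories σi (i < n), and all observations ω0, ωi. Then summing the joint trajectory probability P over all action sequences ai : Fin t → Ai (i < n) equals [μ0 (σ0 0) · (∏_{k<t} T0 (σ0 k) (σ0 (k+1))) · (∏_{k≤t} Z0 (σ0 k) (ω0 k))] · ∏_{i<n} [ μi (σi 0) · (∏_{k<t} e_{i,k}(σ0 k)) · (∏_{k≤t} Zi (σi k) (ωi k)) ], where e_{i,k}(s0) := ∑_{a ∈ Ai} πi s0 (σi k) a · Ti (σi k) a (σi (k+1)). Consequently, when the local trajectories are given, the global state forms a time-inhomogeneous hidden Markov chain with transition matrix T0 and, at each step k, one additional emission factor e_{i,k} per agent. -/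
/-- action marginalization collapses a TI-AASEP to an HMM with extra
emissions: with all trajectories and observations fixed, summing the joint trajectory
probability over all action sequences replaces each per-step agent factor by the
emission factor `e_{i,k}(σ0 k) = ∑ a, πi (σ0 k) (σi k) a * Ti (σi k) a (σi (k+1))`. -/
theorem tiaasep_action_marginalization
    (n t : ℕ)
    {S0 O0 : Type} [Fintype S0] [Nonempty S0] [Fintype O0] [Nonempty O0]
    (S A O : Fin n → Type)
    [∀ i, Fintype (S i)] [∀ i, Nonempty (S i)]
    [∀ i, Fintype (A i)] [∀ i, Nonempty (A i)]
    [∀ i, Fintype (O i)] [∀ i, Nonempty (O i)]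
    (μ0 : S0 → ℝ) (hμ0_nonneg : ∀ s, 0 ≤ μ0 s) (hμ0_sum : ∑ s : S0, μ0 s = 1)
    (T0 : S0 → S0 → ℝ) (hT0_nonneg : ∀ s s', 0 ≤ T0 s s')
    (hT0_sum : ∀ s : S0, ∑ s' : S0, T0 s s' = 1)
    (Z0 : S0 → O0 → ℝ) (hZ0_nonneg : ∀ s o, 0 ≤ Z0 s o)
    (hZ0_sum : ∀ s : S0, ∑ o : O0, Z0 s o = 1)
    (μ : ∀ i, S i → ℝ) (hμ_nonneg : ∀ i s, 0 ≤ μ i s)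
    (hμ_sum : ∀ i, ∑ s : S i, μ i s = 1)
    (π : ∀ i, S0 → S i → A i → ℝ) (hπ_nonneg : ∀ i s0 s a, 0 ≤ π i s0 s a)
    (hπ_sum : ∀ i (s0 : S0) (s : S i), ∑ a : A i, π i s0 s a = 1)
    (T : ∀ i, S i → A i → S i → ℝ) (hT_nonneg : ∀ i s a s', 0 ≤ T i s a s')
    (hT_sum : ∀ i (s : S i) (a : A i), ∑ s' : S i, T i s a s' = 1)
    (Z : ∀ i, S i → O i → ℝ) (hZ_nonneg : ∀ i s o, 0 ≤ Z i s o)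
    (hZ_sum : ∀ i (s : S i), ∑ o : O i, Z i s o = 1)
    (σ0 : Fin (t + 1) → S0) (σ : ∀ i, Fin (t + 1) → S i)
    (ω0 : Fin (t + 1) → O0) (ω : ∀ i, Fin (t + 1) → O i) :
    ∑ a : ∀ i, Fin t → A i,
      (μ0 (σ0 0) * (∏ k : Fin t, T0 (σ0 k.castSucc) (σ0 k.succ)) *
        (∏ k : Fin (t + 1), Z0 (σ0 k) (ω0 k)) *
        ∏ i : Fin n,
          (μ i (σ i 0) *
            (∏ k : Fin t,
              π i (σ0 k.castSucc) (σ i k.castSucc) (a i k) *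
                T i (σ i k.castSucc) (a i k) (σ i k.succ)) *
            ∏ k : Fin (t + 1), Z i (σ i k) (ω i k)))
      = (μ0 (σ0 0) * (∏ k : Fin t, T0 (σ0 k.castSucc) (σ0 k.succ)) *
        (∏ k : Fin (t + 1), Z0 (σ0 k) (ω0 k))) *
        ∏ i : Fin n,
          (μ i (σ i 0) *
            (∏ k : Fin t,
              ∑ a : A i,
                π i (σ0 k.castSucc) (σ i k.castSucc) a *
                  T i (σ i k.castSucc) a (σ i k.succ)) *
            ∏ k : Fin (t + 1), Z i (σ i k) (ω i k)) := by
  rw [← Finset.mul_sum]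
  congr 1
  rw [← Fintype.prod_sum (fun i (a : Fin t → A i) =>
          (μ i (σ i 0) *
            (∏ k : Fin t,
              π i (σ0 k.castSucc) (σ i k.castSucc) (a k) *
                T i (σ i k.castSucc) (a k) (σ i k.succ)) *
            ∏ k : Fin (t + 1), Z i (σ i k) (ω i k)))]
  refine Finset.prod_congr rfl fun i _ => ?_
  rw [← Finset.sum_mul, ← Finset.mul_sum, Fintype.prod_sum]
end
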